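/- arXiv:math/0106208 — 10 statements merged into one kernel-verified Lean document; each statement's English description precedes it below -/
import Mathlib

section
/- Let ϑ₁,ϑ₂,ϑ₃,ϑ∞ ∈ ℂ. If (y,p) is a solution of the Garnier system G₁ in Hamiltonian form with parameters (ϑ₁,ϑ₂,ϑ₃,ϑ∞) on an open set D ⊆ ℂ with 0,1 ∉ D and y(x) ∉ {0,1,x} for all x ∈ D, then y is twice differentiable on D and is a solution of the Painlevé VI equation PVI(α,β,γ,δ) with α = (ϑ∞−1)²/2, β = −ϑ₂²/2, γ = ϑ₃²/2, δ = (1−ϑ₁²)/2. -/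
/-- `y` is a solution of the Painlevé VI equation with parameters `(α,β,γ,δ)`
on the open set `D ⊆ ℂ` (with `0,1 ∉ D` and `y(x) ∉ {0,1,x}` on `D`). -/
def IsPVISolution (α β γ δ : ℂ) (D : Set ℂ) (y : ℂ → ℂ) : Prop :=
  IsOpen D ∧ (0 : ℂ) ∉ D ∧ (1 : ℂ) ∉ D ∧
  (∀ x ∈ D, y x ≠ 0 ∧ y x ≠ 1 ∧ y x ≠ x) ∧
  ∃ y' y'' : ℂ → ℂ,
    (∀ x ∈ D, HasDerivAt y (y' x) x) ∧
    (∀ x ∈ D, HasDerivAt y' (y'' x) x) ∧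
    (∀ x ∈ D,
      y'' x = (1/2) * (1/(y x) + 1/(y x - 1) + 1/(y x - x)) * (y' x)^2
        - (1/x + 1/(x - 1) + 1/(y x - x)) * y' x
        + (y x * (y x - 1) * (y x - x) / (x^2 * (x - 1)^2)) *
          (α + β * x / (y x)^2 + γ * (x - 1) / (y x - 1)^2
            + δ * (x * (x - 1)) / (y x - x)^2))

/-- `(y,p)` is a solution of the Garnier system `G₁` in Hamiltonian form with
parameters `(ϑ₁,ϑ₂,ϑ₃,ϑ∞)` (poles `u₁ = x`, `u₂ = 0`, `u₃ = 1`) on the open set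
`D ⊆ ℂ` (with `0,1 ∉ D` and `y(x) ∉ {0,1,x}` on `D`). -/
def IsGarnier1Solution (ϑ₁ ϑ₂ ϑ₃ ϑinf : ℂ) (D : Set ℂ) (y p : ℂ → ℂ) : Prop :=
  IsOpen D ∧ (0 : ℂ) ∉ D ∧ (1 : ℂ) ∉ D ∧
  (∀ x ∈ D, y x ≠ 0 ∧ y x ≠ 1 ∧ y x ≠ x) ∧
  ∃ y' p' : ℂ → ℂ,
    (∀ x ∈ D, HasDerivAt y (y' x) x) ∧
    (∀ x ∈ D, HasDerivAt p (p' x) x) ∧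
    (∀ x ∈ D, y' x = (y x * (y x - 1) * (y x - x) / (x * (x - 1))) *
        (2 * p x + 1/(y x - x) - ϑ₁/(y x - x) - ϑ₂/(y x) - ϑ₃/(y x - 1))) ∧
    (∀ x ∈ D, p' x = -((3 * (y x)^2 - 2 * (x + 1) * (y x) + x) * (p x)^2
        + (2 * (y x) + x - (x + 1) - ϑ₁ * (2 * (y x) + x - (x + 1))
            - ϑ₂ * (2 * (y x) - (x + 1)) - ϑ₃ * (2 * (y x) + 1 - (x + 1))) * p x
        + (1/4) * (ϑ₁ + ϑ₂ + ϑ₃ - ϑinf) * (ϑ₁ + ϑ₂ + ϑ₃ + ϑinf - 2))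
          / (x * (x - 1)))

set_option maxHeartbeats 4000000 in
/-- A solution of the Garnier system `G₁` in Hamiltonian form yields a solution of
the Painlevé VI equation with `α = (ϑ∞−1)²/2`, `β = −ϑ₂²/2`, `γ = ϑ₃²/2`,
`δ = (1−ϑ₁²)/2`. -/
theorem garnier1_solution_is_PVI_solution
    (ϑ₁ ϑ₂ ϑ₃ ϑinf : ℂ) (D : Set ℂ) (y p : ℂ → ℂ)
    (h : IsGarnier1Solution ϑ₁ ϑ₂ ϑ₃ ϑinf D y p) :
    IsPVISolution ((ϑinf - 1)^2 / 2) (-ϑ₂^2 / 2) (ϑ₃^2 / 2) ((1 - ϑ₁^2) / 2) D y := by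
  obtain ⟨hD, h0, h1, hy, y', p', hy', hp', ey, ep⟩ := h
  refine ⟨hD, h0, h1, hy, y', fun x =>
    ((2 * p' x * (y x * (y x - 1) * (y x - x))
      + 2 * p x * ((y' x * (y x - 1) + y x * y' x) * (y x - x)
          + y x * (y x - 1) * (y' x - 1))
      + (1 - ϑ₁) * (y' x * (y x - 1) + y x * y' x)
      - ϑ₂ * (y' x * (y x - x) + (y x - 1) * (y' x - 1))
      - ϑ₃ * (y' x * (y x - x) + y x * (y' x - 1))) * (x * (x - 1))
      - (2 * p x * (y x * (y x - 1) * (y x - x)) + (1 - ϑ₁) * (y x * (y x - 1))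
        - ϑ₂ * ((y x - 1) * (y x - x)) - ϑ₃ * (y x * (y x - x))) * (2 * x - 1))
      / (x * (x - 1)) ^ 2, hy', ?_, ?_⟩
  · intro x hx
    have hx0 : x ≠ 0 := fun e => h0 (e ▸ hx)
    have hx1 : x - 1 ≠ 0 := fun e => h1 (sub_eq_zero.mp e ▸ hx)
    have Y := hy' x hx
    have P := hp' x hx
    have I := hasDerivAt_id' x
    have Y1 := Y.sub_const 1
    have YX := Y.sub I
    have N := (((((P.const_mul 2).mul ((Y.mul Y1).mul YX)).add
      ((Y.mul Y1).const_mul (1 - ϑ₁))).sub ((Y1.mul YX).const_mul ϑ₂)).sub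
      ((Y.mul YX).const_mul ϑ₃)).div (I.mul (I.sub_const 1)) (mul_ne_zero hx0 hx1)
    refine (N.congr_of_eventuallyEq ?_).congr_deriv ?_
    · filter_upwards [hD.mem_nhds hx] with t ht
      have ht0 : t ≠ 0 := fun e => h0 (e ▸ ht)
      have ht1 : t - 1 ≠ 0 := fun e => h1 (sub_eq_zero.mp e ▸ ht)
      obtain ⟨a, b, c⟩ := hy t ht
      have b' := sub_ne_zero.mpr b
      have c' := sub_ne_zero.mpr c
      rw [ey t ht]
      simp only [Pi.mul_apply, Pi.sub_apply, Pi.add_apply, Pi.div_apply]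
      field_simp
      ring
    · simp only [Pi.mul_apply, Pi.sub_apply, Pi.add_apply]
      congr 1
      ring
  · intro x hx
    have hx0 : x ≠ 0 := fun e => h0 (e ▸ hx)
    have hx1 : x - 1 ≠ 0 := fun e => h1 (sub_eq_zero.mp e ▸ hx)
    obtain ⟨a, b, c⟩ := hy x hx
    have b' := sub_ne_zero.mpr b
    have c' := sub_ne_zero.mpr c
    simp only []
    rw [ep x hx, ey x hx]
    generalize y x = w at *
    generalize p x = q at *
    field_simp
    ring
end

section
/- Let θ₁,θ₂,θ₃ ∈ ℂ with 1+θ₁+θ₂+θ₃ ≠ 0, let D ⊆ ℂ be open with 0,1 ∉ D, and let u : D → ℂ be a twice differentiable nowhere-vanishing function satisfying the hypergeometric equation x(x−1)u''(x) = [2+θ₁+θ₂ − (4+θ₁+2θ₂+θ₃)x]u'(x) − (2+θ₁+θ₂+θ₃)(θ₂+1)u(x) on D. Then the function y(x) := [(1+θ₁+θ₂ − x − θ₂x)u(x) − x(x−1)u'(x)] / [(1+θ₁+θ₂+θ₃)u(x)] satisfies on D the Riccati equation y'(x) = [(1+θ₁+θ₂+θ₃)/(x(x−1))]·y² − [(1+θ₁+θ₂+θ₁x+θ₃x)/(x(x−1))]·y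 + θ₁/(x−1). -/
/-- Solutions of PVI with reducible monodromy: if `u` solves the hypergeometric
equation `x(x−1)u'' = [2+θ₁+θ₂ − (4+θ₁+2θ₂+θ₃)x]u' − (2+θ₁+θ₂+θ₃)(θ₂+1)u`, then
`y = [(1+θ₁+θ₂−x−θ₂x)u − x(x−1)u'] / [(1+θ₁+θ₂+θ₃)u]` solves the Riccati equation
`y' = [(1+θ₁+θ₂+θ₃)/(x(x−1))]y² − [(1+θ₁+θ₂+θ₁x+θ₃x)/(x(x−1))]y + θ₁/(x−1)`. -/
theorem hypergeometric_gives_riccati_solution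
    (θ₁ θ₂ θ₃ : ℂ) (hθ : 1 + θ₁ + θ₂ + θ₃ ≠ 0)
    (D : Set ℂ) (hD : IsOpen D) (h0 : (0 : ℂ) ∉ D) (h1 : (1 : ℂ) ∉ D)
    (u u' u'' : ℂ → ℂ)
    (hu : ∀ x ∈ D, HasDerivAt u (u' x) x)
    (hu' : ∀ x ∈ D, HasDerivAt u' (u'' x) x)
    (hune : ∀ x ∈ D, u x ≠ 0)
    (hhyp : ∀ x ∈ D, x * (x - 1) * u'' x
      = (2 + θ₁ + θ₂ - (4 + θ₁ + 2*θ₂ + θ₃) * x) * u' x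
        - (2 + θ₁ + θ₂ + θ₃) * (θ₂ + 1) * u x)
    (y : ℂ → ℂ)
    (hy : y = fun x => ((1 + θ₁ + θ₂ - x - θ₂ * x) * u x - x * (x - 1) * u' x)
      / ((1 + θ₁ + θ₂ + θ₃) * u x)) :
    ∀ x ∈ D, HasDerivAt y
      (((1 + θ₁ + θ₂ + θ₃) / (x * (x - 1))) * (y x)^2
        - ((1 + θ₁ + θ₂ + θ₁ * x + θ₃ * x) / (x * (x - 1))) * y x
        + θ₁ / (x - 1)) x := by
  intro x hx
  have hx0 : x ≠ 0 := fun h => h0 (h ▸ hx)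
  have hx1 : x - 1 ≠ 0 := fun h => h1 ((sub_eq_zero.mp h) ▸ hx)
  have hux := hune x hx
  have hA : HasDerivAt (fun x : ℂ => 1 + θ₁ + θ₂ - x - θ₂ * x) (-1 - θ₂ * 1) x :=
    ((hasDerivAt_id x).const_sub (1 + θ₁ + θ₂)).sub ((hasDerivAt_id x).const_mul θ₂)
  have hP : HasDerivAt (fun x : ℂ => x * (x - 1)) (1 * (x - 1) + x * 1) x :=
    (hasDerivAt_id x).mul ((hasDerivAt_id x).sub_const 1)
  have hN := ((hA.mul (hu x hx)).sub (hP.mul (hu' x hx))).div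
    ((hu x hx).const_mul (1 + θ₁ + θ₂ + θ₃)) (mul_ne_zero hθ hux)
  have h2 : u'' x = ((2 + θ₁ + θ₂ - (4 + θ₁ + 2*θ₂ + θ₃) * x) * u' x
        - (2 + θ₁ + θ₂ + θ₃) * (θ₂ + 1) * u x) / (x * (x - 1)) := by
    rw [eq_div_iff (mul_ne_zero hx0 hx1), ← hhyp x hx]; ring
  subst hy
  refine hN.congr_deriv ?_
  simp only [Pi.mul_apply, Pi.sub_apply]
  rw [h2]
  field_simp
  ring
end

section
/- Let θ₁,θ₂,θ₃ ∈ ℂ, let D ⊆ ℂ be open with 0,1 ∉ D, and let y : D → ℂ be a differentiable function with y(x) ∉ {0,1,x} for all x ∈ D, satisfying the Riccati equation y'(x) = [(1+θ₁+θ₂+θ₃)/(x(x−1))]·y² − [(1+θ₁+θ₂+θ₁x+θ₃x)/(x(x−1))]·y + θ₁/(x−1). Then y is twice differentiable on D and is a solution of the Painlevé VI equation PVI(α,β,γ,δ) with α = (θ₁+θ₂+θ₃+1)²/2, β = −θ₁²/2, γ = θ₃²/2, δ = (1−θ₂²)/2 (i.e. the parameters corresponding to ϑ∞ = −(θ₁+θ₂+θ₃)).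 -/
/-- A solution of the Riccati equation
`y' = [(1+θ₁+θ₂+θ₃)/(x(x−1))]y² − [(1+θ₁+θ₂+θ₁x+θ₃x)/(x(x−1))]y + θ₁/(x−1)`
with `y(x) ∉ {0,1,x}` is a (twice differentiable) solution of the Painlevé VI
equation with parameters corresponding to `ϑ∞ = −(θ₁+θ₂+θ₃)`. -/
theorem riccati_solution_is_PVI_solution
    (θ₁ θ₂ θ₃ : ℂ)
    (D : Set ℂ) (hD : IsOpen D) (h0 : (0 : ℂ) ∉ D) (h1 : (1 : ℂ) ∉ D)
    (y y' : ℂ → ℂ)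
    (hy : ∀ x ∈ D, HasDerivAt y (y' x) x)
    (hyne : ∀ x ∈ D, y x ≠ 0 ∧ y x ≠ 1 ∧ y x ≠ x)
    (hric : ∀ x ∈ D, y' x
      = ((1 + θ₁ + θ₂ + θ₃) / (x * (x - 1))) * (y x)^2
        - ((1 + θ₁ + θ₂ + θ₁ * x + θ₃ * x) / (x * (x - 1))) * y x
        + θ₁ / (x - 1)) :
    IsPVISolution ((θ₁ + θ₂ + θ₃ + 1)^2 / 2) (-θ₁^2 / 2) (θ₃^2 / 2)
      ((1 - θ₂^2) / 2) D y := by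
  refine ⟨hD, h0, h1, hyne, y', fun x => (((1 + θ₁ + θ₂ + θ₃) * (2 * y x * y' x)
      - ((θ₁ + θ₃) * y x + (1 + θ₁ + θ₂ + θ₁ * x + θ₃ * x) * y' x) + θ₁) * (x * (x - 1))
      - ((1 + θ₁ + θ₂ + θ₃) * (y x)^2 - (1 + θ₁ + θ₂ + θ₁ * x + θ₃ * x) * y x + θ₁ * x)
        * (2 * x - 1)) / (x * (x - 1))^2, hy, ?_, ?_⟩
  · intro x hx
    have hx0 : x ≠ 0 := fun h => h0 (h ▸ hx)
    have hx1 : x - 1 ≠ 0 := fun h => h1 ((sub_eq_zero.mp h) ▸ hx)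
    have hN : HasDerivAt (fun z => (1 + θ₁ + θ₂ + θ₃) * (y z)^2
        - (1 + θ₁ + θ₂ + θ₁ * z + θ₃ * z) * y z + θ₁ * z)
        ((1 + θ₁ + θ₂ + θ₃) * (2 * y x * y' x)
      - ((θ₁ + θ₃) * y x + (1 + θ₁ + θ₂ + θ₁ * x + θ₃ * x) * y' x) + θ₁) x := by
      have hid := hasDerivAt_id' x
      have hc : HasDerivAt (fun z => 1 + θ₁ + θ₂ + θ₁ * z + θ₃ * z) (θ₁ + θ₃) x := by
        have := ((hid.const_mul θ₁).const_add (1 + θ₁ + θ₂)).add (hid.const_mul θ₃)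
        exact this.congr_deriv (by ring)
      have := ((((hy x hx).pow 2).const_mul (1 + θ₁ + θ₂ + θ₃)).sub
        (hc.mul (hy x hx))).add (hid.const_mul θ₁)
      refine this.congr_deriv ?_
      push_cast
      ring
    have hM : HasDerivAt (fun z : ℂ => z * (z - 1)) (2 * x - 1) x := by
      have hid := hasDerivAt_id' x
      refine (hid.mul (hid.sub_const 1)).congr_deriv ?_
      ring
    refine (hN.div hM (mul_ne_zero hx0 hx1)).congr_of_eventuallyEq ?_
    filter_upwards [hD.mem_nhds hx] with z hz
    have hz0 : z ≠ 0 := fun h => h0 (h ▸ hz)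
    have hz1 : z - 1 ≠ 0 := fun h => h1 ((sub_eq_zero.mp h) ▸ hz)
    rw [hric z hz]
    simp only [Pi.div_apply]
    field_simp
  · intro x hx
    have hx0 : x ≠ 0 := fun h => h0 (h ▸ hx)
    have hx1 : x - 1 ≠ 0 := fun h => h1 ((sub_eq_zero.mp h) ▸ hx)
    obtain ⟨hy0, hy1, hyx⟩ := hyne x hx
    have hy1' : y x - 1 ≠ 0 := sub_ne_zero.mpr hy1
    have hyx' : y x - x ≠ 0 := sub_ne_zero.mpr hyx
    have hr := hric x hx
    simp only []
    rw [hr]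
    generalize y x = w at *
    field_simp
    ring
end

section
/- Let θ₁,θ₂,θ₃ ∈ ℂ, let D ⊆ ℂ be open with 0,1 ∉ D, and let f : D → ℂ be a differentiable function with f(x) ∉ {0,1,x} for all x ∈ D satisfying the Riccati equation f'(x) = [f(f−1)(f−x)/(x(x−1))]·[ (θ₃−θ₂−θ₁)/(2f) + (θ₁+θ₂+θ₃+2)/(2(f−x)) + (θ₁−θ₂−θ₃)/(2(f−1)) ]. Define y(x) := f·[ f·(−θ₁+θ₂+θ₃ − x(θ₁+θ₂+θ₃)) + 2θ₁x ] / [ (−θ₁+θ₂−θ₃)f² + 2(θ₃−θ₂x)f + (θ₁+θ₂−θ₃)x ], and assume that for all x ∈ D the denominator is nonzero and y(x) ∉ {0,1,x}. Then y is a solution of the Painlevé VI equation PVI(α,β,γ,δ) with α = 1/2, β = −θ₁²/2, γ = θ₃²/2, δ = (1−θ₂²)/2 (i.e. the parameters corresponding to ϑ∞ = 2). -/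
/-- Algebraic identity behind the first Hamilton equation. -/
lemma alg_y (a b c x f g y p : ℂ) (hx : x ≠ 0) (hx1 : x - 1 ≠ 0)
    (hf0 : f ≠ 0) (hf1 : f - 1 ≠ 0) (hfx : f - x ≠ 0)
    (hg : g = (f * (f - 1) * (f - x) / (x * (x - 1))) *
        ((c - b - a) / (2 * f) + (a + b + c + 2) / (2 * (f - x))
          + (a - b - c) / (2 * (f - 1))))
    (Q N : ℂ) (hQ : Q = (-a + b - c) * f^2 + 2 * (c - b * x) * f + (a + b - c) * x)
    (hN : N = f * (f * (-a + b + c - x * (a + b + c)) + 2 * a * x))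
    (hQ0 : Q ≠ 0) (hy : y = N / Q)
    (hp : p = -Q / (2 * (f * (f - 1) * (f - x)))) :
    ((g * (f * (-a + b + c - x * (a + b + c)) + 2 * a * x)
      + f * (g * (-a + b + c - x * (a + b + c)) + f * (-(a + b + c)) + 2 * a)) * Q
      - N * ((-a + b - c) * (2 * f * g) + (2 * (-b) * f + 2 * (c - b * x) * g)
          + (a + b - c))) / Q^2
    = (a * (y - 1) * (y - x) + c * y * (y - x) + (1 - b) * y * (y - 1)
        + 2 * (y * (y - 1) * (y - x)) * p) / (x * (x - 1)) := by
  have hg' : g = ((c - b - a) * (f - 1) * (f - x) + (a + b + c + 2) * f * (f - 1)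
      + (a - b - c) * f * (f - x)) / (2 * (x * (x - 1))) := by
    rw [hg]; field_simp
  have e0 : y = f * (f * (-a + b + c - x * (a + b + c)) + 2 * a * x) / Q := by rw [hy, hN]
  have e1 : y - 1 = (f - 1) * (f * (2 * c - x * (a + b + c)) + (a + b - c) * x) / Q := by
    rw [e0]; field_simp; rw [hQ]; ring
  have e2 : y - x = (f - x) * (f * (-a + b + c - 2 * x * b) + (a + b - c) * x) / Q := by
    rw [e0]; field_simp; rw [hQ]; ring
  have e3 : 2 * (y * (y - 1) * (y - x)) * p
      = - ((f * (-a + b + c - x * (a + b + c)) + 2 * a * x)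
        * (f * (2 * c - x * (a + b + c)) + (a + b - c) * x)
        * (f * (-a + b + c - 2 * x * b) + (a + b - c) * x)) / Q^2 := by
    rw [e1, e2, e0, hp]; field_simp
  rw [e3, e1, e2, e0, hg', hN]
  field_simp
  rw [hQ]
  ring

/-- Algebraic identity behind the second Hamilton equation. -/
lemma alg_p (a b c x f g y p : ℂ) (hx : x ≠ 0) (hx1 : x - 1 ≠ 0)
    (hf0 : f ≠ 0) (hf1 : f - 1 ≠ 0) (hfx : f - x ≠ 0)
    (hg : g = (f * (f - 1) * (f - x) / (x * (x - 1))) *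
        ((c - b - a) / (2 * f) + (a + b + c + 2) / (2 * (f - x))
          + (a - b - c) / (2 * (f - 1))))
    (Q N : ℂ) (hQ : Q = (-a + b - c) * f^2 + 2 * (c - b * x) * f + (a + b - c) * x)
    (hN : N = f * (f * (-a + b + c - x * (a + b + c)) + 2 * a * x))
    (hQ0 : Q ≠ 0) (hy : y = N / Q)
    (hp : p = -Q / (2 * (f * (f - 1) * (f - x)))) :
    (-((-a + b - c) * (2 * f * g) + (2 * (-b) * f + 2 * (c - b * x) * g)
          + (a + b - c)) * (2 * (f * (f - 1) * (f - x)))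
      - (-Q) * (2 * ((g * (f - 1) + f * g) * (f - x) + f * (f - 1) * (g - 1))))
        / (2 * (f * (f - 1) * (f - x)))^2
    = -(((y - 1) * (y - x) + y * (y - x) + y * (y - 1)) * p^2
        + (a * (2 * y - 1 - x) + c * (2 * y - x) + (1 - b) * (2 * y - 1)) * p
        + ((a + c + 1 - b)^2 - 1) / 4) / (x * (x - 1)) := by
  have hg' : g = ((c - b - a) * (f - 1) * (f - x) + (a + b + c + 2) * f * (f - 1)
      + (a - b - c) * f * (f - x)) / (2 * (x * (x - 1))) := by
    rw [hg]; field_simp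
  have q0 : y * p = - N / (2 * (f * (f - 1) * (f - x))) := by
    rw [hy, hp]; field_simp
  have e : ((y - 1) * (y - x) + y * (y - x) + y * (y - 1)) * p^2
        + (a * (2 * y - 1 - x) + c * (2 * y - x) + (1 - b) * (2 * y - 1)) * p
      = (3 * (y * p)^2 - 2 * (1 + x) * (y * p) * p + x * p^2)
        + 2 * (a + c + 1 - b) * (y * p) - (a * (1 + x) + c * x + (1 - b)) * p := by ring
  rw [e, q0, hp, hg']
  field_simp
  rw [hQ, hN]
  ring

/-- Eliminating `p` from the Hamiltonian system gives PVI. -/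
lemma alg_pvi (a b c x y p y1 p1 : ℂ) (hx : x ≠ 0) (hx1 : x - 1 ≠ 0)
    (h0 : y ≠ 0) (h1 : y - 1 ≠ 0) (h2 : y - x ≠ 0)
    (hy1 : y1 = (a * (y - 1) * (y - x) + c * y * (y - x) + (1 - b) * y * (y - 1)
        + 2 * (y * (y - 1) * (y - x)) * p) / (x * (x - 1)))
    (hp1 : p1 = -(((y - 1) * (y - x) + y * (y - x) + y * (y - 1)) * p^2
        + (a * (2 * y - 1 - x) + c * (2 * y - x) + (1 - b) * (2 * y - 1)) * p
        + ((a + c + 1 - b)^2 - 1) / 4) / (x * (x - 1))) :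
    ((a * y1 * (y - x) + a * (y - 1) * (y1 - 1) + (c * y1 * (y - x) + c * y * (y1 - 1))
      + ((1 - b) * y1 * (y - 1) + (1 - b) * y * y1)
      + (2 * ((y1 * (y - 1) + y * y1) * (y - x) + y * (y - 1) * (y1 - 1)) * p
        + 2 * (y * (y - 1) * (y - x)) * p1)) * (x * (x - 1))
      - (a * (y - 1) * (y - x) + c * y * (y - x) + (1 - b) * y * (y - 1)
        + 2 * (y * (y - 1) * (y - x)) * p) * (1 * (x - 1) + x * 1)) / (x * (x - 1))^2
    = (1/2) * (1/y + 1/(y - 1) + 1/(y - x)) * y1^2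
        - (1/x + 1/(x - 1) + 1/(y - x)) * y1
        + (y * (y - 1) * (y - x) / (x^2 * (x - 1)^2)) *
          (1/2 + (-a^2/2) * x / y^2 + (c^2/2) * (x - 1) / (y - 1)^2
            + ((1 - b^2)/2) * (x * (x - 1)) / (y - x)^2) := by
  rw [hp1, hy1]
  field_simp
  ring

/-- Riccati-type solutions of PVI for `ϑ∞ = 2`: if `f` solves the Riccati equation
`f' = [f(f−1)(f−x)/(x(x−1))]·[(θ₃−θ₂−θ₁)/(2f) + (θ₁+θ₂+θ₃+2)/(2(f−x)) + (θ₁−θ₂−θ₃)/(2(f−1))]`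
then `y = f·[f(−θ₁+θ₂+θ₃ − x(θ₁+θ₂+θ₃)) + 2θ₁x] / [(−θ₁+θ₂−θ₃)f² + 2(θ₃−θ₂x)f + (θ₁+θ₂−θ₃)x]`
solves PVI with `α = 1/2`, `β = −θ₁²/2`, `γ = θ₃²/2`, `δ = (1−θ₂²)/2`. -/
theorem riccati_type_solution_is_PVI_solution
    (θ₁ θ₂ θ₃ : ℂ)
    (D : Set ℂ) (hD : IsOpen D) (h0 : (0 : ℂ) ∉ D) (h1 : (1 : ℂ) ∉ D)
    (f f' : ℂ → ℂ)
    (hf : ∀ x ∈ D, HasDerivAt f (f' x) x)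
    (hfne : ∀ x ∈ D, f x ≠ 0 ∧ f x ≠ 1 ∧ f x ≠ x)
    (hric : ∀ x ∈ D, f' x
      = (f x * (f x - 1) * (f x - x) / (x * (x - 1))) *
        ((θ₃ - θ₂ - θ₁) / (2 * f x) + (θ₁ + θ₂ + θ₃ + 2) / (2 * (f x - x))
          + (θ₁ - θ₂ - θ₃) / (2 * (f x - 1))))
    (y : ℂ → ℂ)
    (hy : y = fun x =>
      f x * (f x * (-θ₁ + θ₂ + θ₃ - x * (θ₁ + θ₂ + θ₃)) + 2 * θ₁ * x)
        / ((-θ₁ + θ₂ - θ₃) * (f x)^2 + 2 * (θ₃ - θ₂ * x) * f x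
            + (θ₁ + θ₂ - θ₃) * x))
    (hden : ∀ x ∈ D,
      (-θ₁ + θ₂ - θ₃) * (f x)^2 + 2 * (θ₃ - θ₂ * x) * f x + (θ₁ + θ₂ - θ₃) * x ≠ 0)
    (hyne : ∀ x ∈ D, y x ≠ 0 ∧ y x ≠ 1 ∧ y x ≠ x) :
    IsPVISolution (1/2) (-θ₁^2 / 2) (θ₃^2 / 2) ((1 - θ₂^2) / 2) D y := by
  have hQd : ∀ x ∈ D, HasDerivAt (fun x => (-θ₁ + θ₂ - θ₃) * (f x)^2 + 2 * (θ₃ - θ₂ * x) * f x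
      + (θ₁ + θ₂ - θ₃) * x) ((-θ₁ + θ₂ - θ₃) * (2 * f x * f' x)
        + (2 * (-θ₂) * f x + 2 * (θ₃ - θ₂ * x) * f' x) + (θ₁ + θ₂ - θ₃)) x := by
    intro x hx
    have hi := hasDerivAt_id' x
    have := ((((hf x hx).pow 2).const_mul (-θ₁ + θ₂ - θ₃)).add
      ((((hi.const_mul θ₂).const_sub θ₃).const_mul 2).mul (hf x hx))).add
      (hi.const_mul (θ₁ + θ₂ - θ₃))
    refine this.congr_deriv ?_
    push_cast
    ring
  have hx0 : ∀ x ∈ D, x ≠ 0 := fun x hx h => h0 (h ▸ hx)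
  have hx1 : ∀ x ∈ D, x - 1 ≠ 0 := fun x hx h => h1 (sub_eq_zero.mp h ▸ hx)
  obtain ⟨p, hp⟩ : ∃ p : ℂ → ℂ, p = fun x => -((-θ₁ + θ₂ - θ₃) * (f x)^2
      + 2 * (θ₃ - θ₂ * x) * f x + (θ₁ + θ₂ - θ₃) * x)
      / (2 * (f x * (f x - 1) * (f x - x))) := ⟨_, rfl⟩
  obtain ⟨y1, hy1⟩ : ∃ y1 : ℂ → ℂ, y1 = fun x => (θ₁ * (y x - 1) * (y x - x)
      + θ₃ * y x * (y x - x) + (1 - θ₂) * y x * (y x - 1)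
      + 2 * (y x * (y x - 1) * (y x - x)) * p x) / (x * (x - 1)) := ⟨_, rfl⟩
  have hyd : ∀ x ∈ D, HasDerivAt y (y1 x) x := by
    intro x hx
    have hi := hasDerivAt_id' x
    obtain ⟨f0, f1, f2⟩ := hfne x hx
    have hfd := hf x hx
    have hNd := hfd.mul ((hfd.mul ((hi.mul_const (θ₁ + θ₂ + θ₃)).const_sub
      (-θ₁ + θ₂ + θ₃))).add (hi.const_mul (2 * θ₁)))
    have hd := hNd.div (hQd x hx) (hden x hx)
    have key := alg_y θ₁ θ₂ θ₃ x (f x) (f' x) (y x) (p x) (hx0 x hx) (hx1 x hx) f0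
      (sub_ne_zero.mpr f1) (sub_ne_zero.mpr f2) (hric x hx) _ _ rfl rfl (hden x hx)
      (by rw [hy]) (by rw [hp])
    have e : y1 x = _ := congrFun hy1 x
    rw [e, ← key]
    have hd2 := hd.congr_of_eventuallyEq (f₁ := y) (by rw [hy]; exact Filter.EventuallyEq.rfl)
    refine hd2.congr_deriv ?_
    simp only [Pi.mul_apply, Pi.add_apply]
    ring
  have hpd : ∀ x ∈ D, HasDerivAt p (-(((y x - 1) * (y x - x) + y x * (y x - x)
        + y x * (y x - 1)) * (p x)^2
        + (θ₁ * (2 * y x - 1 - x) + θ₃ * (2 * y x - x) + (1 - θ₂) * (2 * y x - 1)) * p x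
        + ((θ₁ + θ₃ + 1 - θ₂)^2 - 1) / 4) / (x * (x - 1))) x := by
    intro x hx
    have hi := hasDerivAt_id' x
    obtain ⟨f0, f1, f2⟩ := hfne x hx
    have hfd := hf x hx
    have hFd := (((hfd.mul (hfd.sub_const 1)).mul (hfd.sub hi)).const_mul 2)
    have hd := (hQd x hx).neg.div hFd (mul_ne_zero two_ne_zero (mul_ne_zero (mul_ne_zero f0
      (sub_ne_zero.mpr f1)) (sub_ne_zero.mpr f2)))
    have key := alg_p θ₁ θ₂ θ₃ x (f x) (f' x) (y x) (p x) (hx0 x hx) (hx1 x hx) f0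
      (sub_ne_zero.mpr f1) (sub_ne_zero.mpr f2) (hric x hx) _ _ rfl rfl (hden x hx)
      (by rw [hy]) (by rw [hp])
    rw [← key]
    have hd2 := hd.congr_of_eventuallyEq (f₁ := p) (by rw [hp]; exact Filter.EventuallyEq.rfl)
    exact hd2
  refine ⟨hD, h0, h1, hyne, y1, _, hyd, ?_, fun x hx => rfl⟩
  intro x hx
  have hi := hasDerivAt_id' x
  obtain ⟨n0, n1, n2⟩ := hyne x hx
  have hv := hyd x hx
  have hA := ((((hv.sub_const 1).const_mul θ₁).mul (hv.sub hi)).add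
    ((hv.const_mul θ₃).mul (hv.sub hi))).add ((hv.const_mul (1 - θ₂)).mul (hv.sub_const 1))
  have hB := (((hv.mul (hv.sub_const 1)).mul (hv.sub hi)).const_mul 2).mul (hpd x hx)
  have hd := (hA.add hB).div (hi.mul (hi.sub_const 1))
    (mul_ne_zero (hx0 x hx) (hx1 x hx))
  have key := alg_pvi θ₁ θ₂ θ₃ x (y x) (p x) (y1 x) _ (hx0 x hx) (hx1 x hx) n0
    (sub_ne_zero.mpr n1) (sub_ne_zero.mpr n2) (congrFun hy1 x) rfl
  have hd2 := hd.congr_of_eventuallyEq (f₁ := y1) (by rw [hy1]; exact Filter.EventuallyEq.rfl)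
  exact hd2.congr_deriv key
end

section
/- Let (α,β,γ,δ) ∈ ℂ⁴ and let y be a solution of the Painlevé VI equation PVI(α,β,γ,δ) on an open set D ⊆ ℂ with 0,1 ∉ D. Let D' := {x ∈ ℂ : 1−x ∈ D}. Then 0,1 ∉ D', the function z(x) := 1 − y(1−x) satisfies z(x) ∉ {0,1,x} for all x ∈ D', and z is a solution of the Painlevé VI equation PVI(α, −γ, −β, δ) on D'. -/
/-- The symmetry `x ↦ 1−x`, `y ↦ 1−y` of the Painlevé VI equation:
it maps solutions of `PVI(α,β,γ,δ)` to solutions of `PVI(α,−γ,−β,δ)`. -/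
theorem PVI_symmetry_one_sub
    (α β γ δ : ℂ) (D : Set ℂ) (y : ℂ → ℂ)
    (h : IsPVISolution α β γ δ D y)
    (D' : Set ℂ) (hD' : D' = {x : ℂ | 1 - x ∈ D})
    (z : ℂ → ℂ) (hz : z = fun x => 1 - y (1 - x)) :
    (0 : ℂ) ∉ D' ∧ (1 : ℂ) ∉ D' ∧
    (∀ x ∈ D', z x ≠ 0 ∧ z x ≠ 1 ∧ z x ≠ x) ∧
    IsPVISolution α (-γ) (-β) δ D' z := by
  subst hD' hz
  obtain ⟨ho, h0, h1, hne, y', y'', hd, hd', he⟩ := h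
  have a0 : (0 : ℂ) ∉ {x : ℂ | 1 - x ∈ D} := by simpa using h1
  have a1 : (1 : ℂ) ∉ {x : ℂ | 1 - x ∈ D} := by simpa using h0
  have a2 : ∀ x ∈ {x : ℂ | 1 - x ∈ D},
      (fun x => 1 - y (1 - x)) x ≠ 0 ∧ (fun x => 1 - y (1 - x)) x ≠ 1 ∧
        (fun x => 1 - y (1 - x)) x ≠ x := by
    intro x hx
    obtain ⟨b0, b1, b2⟩ := hne (1 - x) hx
    refine ⟨fun e => b1 ?_, fun e => b0 ?_, fun e => b2 ?_⟩
    · linear_combination -e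
    · linear_combination -e
    · linear_combination -e
  have hsub : ∀ x : ℂ, HasDerivAt (fun x : ℂ => 1 - x) (-1) x := fun x => by
    simpa using (hasDerivAt_id x).const_sub 1
  refine ⟨a0, a1, a2, ?_, a0, a1, a2, fun x => y' (1 - x), fun x => -y'' (1 - x), ?_, ?_, ?_⟩
  · exact ho.preimage (continuous_const.sub continuous_id)
  · intro x hx
    have := ((hd (1 - x) hx).comp x (hsub x)).const_sub 1
    simpa [Function.comp_def] using this
  · intro x hx
    have := (hd' (1 - x) hx).comp x (hsub x)
    simpa [Function.comp_def] using this
  · intro x hx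
    have e := he (1 - x) hx
    simp only
    rw [e]
    generalize y (1 - x) = Y
    generalize y' (1 - x) = P
    obtain ⟨t, rfl⟩ : ∃ t, x = 1 - t := ⟨1 - x, by ring⟩
    have c1 : 1 - (1 - t) = t := by ring
    have c2 : 1 - t - 1 = -t := by ring
    have c3 : 1 - Y - 1 = -Y := by ring
    have c4 : 1 - Y - (1 - t) = -(Y - t) := by ring
    have c5 : 1 - t = -(t - 1) := by ring
    have c6 : 1 - Y = -(Y - 1) := by ring
    rw [c1, c2, c3, c4, c5, c6]
    generalize Y - 1 = U
    generalize Y - t = V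
    generalize t - 1 = s
    simp only [div_neg, neg_sq]
    ring
end

section
/- Let (α,β,γ,δ) ∈ ℂ⁴ and let y be a solution of the Painlevé VI equation PVI(α,β,γ,δ) on an open set D ⊆ ℂ with 0,1 ∉ D. Let D' := {x ∈ ℂ : x ≠ 0 and 1/x ∈ D}. Then 0,1 ∉ D', the function z(x) := 1/y(1/x) satisfies z(x) ∉ {0,1,x} for all x ∈ D', and z is a solution of the Painlevé VI equation PVI(−β, −α, γ, δ) on D'. -/
theorem PVI_alg (α β γ δ x Y P Q : ℂ) (hx : x ≠ 0) (hx1 : 1 - x ≠ 0) (hY : Y ≠ 0)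
    (hY1 : Y - 1 ≠ 0) (hYx : Y * x - 1 ≠ 0)
    (hQ : Q = (1/2) * (1/Y + 1/(Y - 1) + 1/(Y - 1/x)) * P^2
        - (1/(1/x) + 1/(1/x - 1) + 1/(Y - 1/x)) * P
        + (Y * (Y - 1) * (Y - 1/x) / ((1/x)^2 * (1/x - 1)^2)) *
          (α + β * (1/x) / Y^2 + γ * (1/x - 1) / (Y - 1)^2
            + δ * ((1/x) * (1/x - 1)) / (Y - 1/x)^2)) :
    -Q / (x^4 * Y^2) - 2 * P / (x^3 * Y^2) + 2 * P^2 / (x^4 * Y^3) =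
      (1/2) * (1/(1/Y) + 1/(1/Y - 1) + 1/(1/Y - x)) * (P / (x^2 * Y^2))^2
        - (1/x + 1/(x - 1) + 1/(1/Y - x)) * (P / (x^2 * Y^2))
        + ((1/Y) * (1/Y - 1) * (1/Y - x) / (x^2 * (x - 1)^2)) *
          (-β + -α * x / (1/Y)^2 + γ * (x - 1) / (1/Y - 1)^2
            + δ * (x * (x - 1)) / (1/Y - x)^2) := by
  have e1 : Y - 1/x = (Y * x - 1) / x := by field_simp
  have e2 : 1/x - 1 = (1 - x) / x := by field_simp
  have e3 : 1/Y - 1 = -(Y - 1) / Y := by field_simp; ring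
  have e4 : 1/Y - x = -(Y * x - 1) / Y := by field_simp; ring
  have e5 : x - 1 = -(1 - x) := by ring
  rw [e1, e2] at hQ
  rw [e3, e4, e5, hQ]
  obtain ⟨A, hA⟩ : ∃ A, A = 1 - x := ⟨_, rfl⟩
  obtain ⟨B, hB⟩ : ∃ B, B = Y - 1 := ⟨_, rfl⟩
  obtain ⟨C, hC⟩ : ∃ C, C = Y * x - 1 := ⟨_, rfl⟩
  rw [← hA] at hx1 ⊢
  rw [← hB] at hY1 ⊢
  rw [← hC] at hYx ⊢
  field_simp
  subst hA hB hC
  ring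

/-- The symmetry `x ↦ 1/x`, `y ↦ 1/y` of the Painlevé VI equation:
it maps solutions of `PVI(α,β,γ,δ)` to solutions of `PVI(−β,−α,γ,δ)`. -/
theorem PVI_symmetry_inv
    (α β γ δ : ℂ) (D : Set ℂ) (y : ℂ → ℂ)
    (h : IsPVISolution α β γ δ D y)
    (D' : Set ℂ) (hD' : D' = {x : ℂ | x ≠ 0 ∧ 1/x ∈ D})
    (z : ℂ → ℂ) (hz : z = fun x => 1 / y (1/x)) :
    (0 : ℂ) ∉ D' ∧ (1 : ℂ) ∉ D' ∧
    (∀ x ∈ D', z x ≠ 0 ∧ z x ≠ 1 ∧ z x ≠ x) ∧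
    IsPVISolution (-β) (-α) γ δ D' z := by
  obtain ⟨ho, h0, h1, hne, y', y'', hy', hy'', heq⟩ := h
  have k0 : (0 : ℂ) ∉ D' := by rw [hD']; simp
  have k1 : (1 : ℂ) ∉ D' := by rw [hD']; simpa using h1
  have kne : ∀ x ∈ D', z x ≠ 0 ∧ z x ≠ 1 ∧ z x ≠ x := by
    intro x hx
    rw [hD'] at hx
    obtain ⟨hx0, hxD⟩ := hx
    obtain ⟨a, b, c⟩ := hne _ hxD
    rw [hz]
    refine ⟨one_div_ne_zero a, fun e => b ?_, fun e => c ?_⟩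
    · have e : 1 / y (1/x) = 1 := e
      rw [← one_div_one_div (y (1/x)), e, one_div_one]
    · have e : 1 / y (1/x) = x := e
      rw [← one_div_one_div (y (1/x)), e]
  refine ⟨k0, k1, kne, ?_, k0, k1, kne, fun x => y' (1/x) / (x^2 * y (1/x)^2),
    fun x => -y'' (1/x) / (x^4 * y (1/x)^2) - 2 * y' (1/x) / (x^3 * y (1/x)^2)
      + 2 * y' (1/x)^2 / (x^4 * y (1/x)^3), ?_, ?_, ?_⟩
  · have hc : ContinuousOn (fun x : ℂ => 1/x) {0}ᶜ :=
      continuousOn_const.div continuousOn_id (fun x hx => hx)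
    have := hc.isOpen_inter_preimage isOpen_compl_singleton ho
    rw [hD']
    exact this
  all_goals
    intro x hx
    rw [hD'] at hx
    obtain ⟨hx0, hxD⟩ := hx
    obtain ⟨a, b, c⟩ := hne _ hxD
    have hi : HasDerivAt (fun x : ℂ => 1/x) (-(x^2)⁻¹) x := by
      simpa using hasDerivAt_inv hx0
    have hY : HasDerivAt (fun x : ℂ => y (1/x)) (y' (1/x) * -(x^2)⁻¹) x :=
      HasDerivAt.comp x (hy' _ hxD) hi
    have hP : HasDerivAt (fun x : ℂ => y' (1/x)) (y'' (1/x) * -(x^2)⁻¹) x :=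
      HasDerivAt.comp x (hy'' _ hxD) hi
  · rw [hz]
    refine ((hasDerivAt_const x (1:ℂ)).fun_div hY a).congr_deriv ?_
    field_simp
    ring
  · refine (hP.fun_div (((hasDerivAt_id' x).fun_pow 2).fun_mul (hY.fun_pow 2))
      (mul_ne_zero (pow_ne_zero 2 hx0) (pow_ne_zero 2 a))).congr_deriv ?_
    field_simp
    push_cast
    ring
  · rw [hz]
    refine PVI_alg α β γ δ x (y (1/x)) (y' (1/x)) (y'' (1/x)) hx0 ?_ a (sub_ne_zero.2 b) ?_
      (heq _ hxD)
    · intro e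
      apply h1
      have : x = 1 := by linear_combination -e
      rw [this] at hxD
      simpa using hxD
    · intro e
      apply c
      field_simp
      linear_combination e
end

section
/- Let (α,β,γ,δ) ∈ ℂ⁴ and let y be a solution of the Painlevé VI equation PVI(α,β,γ,δ) on an open set D ⊆ ℂ with 0,1 ∉ D. Let D' := {x ∈ ℂ : x ≠ 1 and x/(x−1) ∈ D}. Then 0,1 ∉ D', the function z(x) := (s − y(s))/(s − 1) with s = x/(x−1) satisfies z(x) ∉ {0,1,x} for all x ∈ D', and z is a solution of the Painlevé VI equation PVI(α, δ − 1/2, γ, β + 1/2) on D'. -/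
/-- The algebraic identity behind the symmetry. -/
lemma PVI_symmetry_algebra (α β γ δ x w q Y s : ℂ) (hx0 : x ≠ 0) (hx1 : x - 1 ≠ 0)
    (hw0 : w ≠ 0) (hw1 : w - 1 ≠ 0) (hwx : w - x ≠ 0)
    (hY : Y = -(w - x) / (x - 1)) (hs : s = x / (x - 1)) :
    -((1/2) * (1/Y + 1/(Y - 1) + 1/(Y - s)) * q^2
        - (1/s + 1/(s - 1) + 1/(Y - s)) * q
        + (Y * (Y - 1) * (Y - s) / (s^2 * (s - 1)^2)) *
          (α + β * s / Y^2 + γ * (s - 1) / (Y - 1)^2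
            + δ * (s * (s - 1)) / (Y - s)^2)) / (x - 1)^3
    = (1/2) * (1/w + 1/(w - 1) + 1/(w - x)) * (1 - Y + q / (x - 1))^2
        - (1/x + 1/(x - 1) + 1/(w - x)) * (1 - Y + q / (x - 1))
        + (w * (w - 1) * (w - x) / (x^2 * (x - 1)^2)) *
          (α + (δ - 1/2) * x / w^2 + γ * (x - 1) / (w - 1)^2
            + (β + 1/2) * (x * (x - 1)) / (w - x)^2) := by
  have h1 : Y - 1 = -(w - 1) / (x - 1) := by rw [hY]; field_simp; ring
  have h2 : Y - s = -w / (x - 1) := by rw [hY, hs]; field_simp; ring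
  have h3 : s - 1 = 1 / (x - 1) := by rw [hs]; field_simp; ring
  have h4 : 1 - Y = (w - 1) / (x - 1) := by rw [hY]; field_simp; ring
  rw [h1, h2, h3, h4, hY, hs]
  field_simp
  ring


/-- The symmetry `x ↦ x/(x−1)`, `y ↦ (x/(x−1) − y)/(x/(x−1) − 1)` of the Painlevé VI
equation: it maps solutions of `PVI(α,β,γ,δ)` to solutions of
`PVI(α, δ−1/2, γ, β+1/2)`. -/
theorem PVI_symmetry_x_div_x_sub_one
    (α β γ δ : ℂ) (D : Set ℂ) (y : ℂ → ℂ)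
    (h : IsPVISolution α β γ δ D y)
    (D' : Set ℂ) (hD' : D' = {x : ℂ | x ≠ 1 ∧ x/(x - 1) ∈ D})
    (z : ℂ → ℂ) (hz : z = fun x => (x/(x - 1) - y (x/(x - 1))) / (x/(x - 1) - 1)) :
    (0 : ℂ) ∉ D' ∧ (1 : ℂ) ∉ D' ∧
    (∀ x ∈ D', z x ≠ 0 ∧ z x ≠ 1 ∧ z x ≠ x) ∧
    IsPVISolution α (δ - 1/2) γ (β + 1/2) D' z := by
  obtain ⟨hDo, hD0, hD1, hne, y', y'', hy', hy'', hode⟩ := h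
  have hzx : ∀ x : ℂ, x ≠ 1 → z x = x - (x - 1) * y (x/(x - 1)) := by
    intro x hx
    have hx1 : x - 1 ≠ 0 := sub_ne_zero.mpr hx
    have h3 : x/(x - 1) - 1 = 1 / (x - 1) := by field_simp; ring
    rw [hz]
    simp only [h3]
    field_simp
  have h0 : (0 : ℂ) ∉ D' := by
    rw [hD']; rintro ⟨_, h⟩; exact hD0 (by simpa using h)
  have h1 : (1 : ℂ) ∉ D' := by
    rw [hD']; rintro ⟨h, _⟩; exact h rfl
  have hmem : ∀ x ∈ D', x ≠ 1 ∧ x/(x - 1) ∈ D := by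
    intro x hx; rw [hD'] at hx; exact hx
  have hzne : ∀ x ∈ D', z x ≠ 0 ∧ z x ≠ 1 ∧ z x ≠ x := by
    intro x hx
    obtain ⟨hx1, hxD⟩ := hmem x hx
    have hx1' : x - 1 ≠ 0 := sub_ne_zero.mpr hx1
    obtain ⟨a, b, c⟩ := hne _ hxD
    rw [hzx x hx1]
    refine ⟨fun e => c ?_, fun e => b ?_, fun e => a ?_⟩
    · rw [eq_div_iff hx1']; linear_combination -e
    · apply mul_left_cancel₀ hx1'; linear_combination -e
    · apply mul_left_cancel₀ hx1'; linear_combination -e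
  have hs : ∀ x : ℂ, x ≠ 1 → HasDerivAt (fun x : ℂ => x/(x - 1)) (-1/(x - 1)^2) x := by
    intro x hx
    have hx1' : x - 1 ≠ 0 := sub_ne_zero.mpr hx
    have := (hasDerivAt_id x).div ((hasDerivAt_id x).sub_const 1) hx1'
    refine HasDerivAt.congr_deriv this ?_
    simp only [id]
    congr 1
    ring
  have hopen : IsOpen D' := by
    rw [isOpen_iff_mem_nhds]
    intro x hx
    obtain ⟨hx1, hxD⟩ := hmem x hx
    have e1 : ∀ᶠ u in nhds x, u/(u - 1) ∈ D :=
      (hs x hx1).continuousAt.eventually (hDo.mem_nhds hxD)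
    have e2 : ∀ᶠ u in nhds x, u ≠ 1 := isOpen_ne.mem_nhds hx1
    rw [hD']
    filter_upwards [e1, e2] with u hu1 hu2
    exact ⟨hu2, hu1⟩
  refine ⟨h0, h1, hzne, hopen, h0, h1, hzne,
    fun x => 1 - y (x/(x - 1)) + y' (x/(x - 1)) / (x - 1),
    fun x => -(y'' (x/(x - 1))) / (x - 1)^3, ?_, ?_, ?_⟩
  · intro x hx
    obtain ⟨hx1, hxD⟩ := hmem x hx
    have hx1' : x - 1 ≠ 0 := sub_ne_zero.mpr hx1
    have hc : HasDerivAt (fun u : ℂ => y (u/(u - 1))) (y' (x/(x - 1)) * (-1/(x - 1)^2)) x :=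
      HasDerivAt.comp x (hy' _ hxD) (hs x hx1)
    have hd := (hasDerivAt_id x).sub (((hasDerivAt_id x).sub_const 1).mul hc)
    have e2 : ∀ᶠ u in nhds x, u ≠ 1 := isOpen_ne.mem_nhds hx1
    refine HasDerivAt.congr_of_eventuallyEq (HasDerivAt.congr_deriv hd ?_)
      (e2.mono fun u hu => ?_)
    · simp only [id]; field_simp; ring
    · simpa using hzx u hu
  · intro x hx
    obtain ⟨hx1, hxD⟩ := hmem x hx
    have hx1' : x - 1 ≠ 0 := sub_ne_zero.mpr hx1
    have hc : HasDerivAt (fun u : ℂ => y (u/(u - 1))) (y' (x/(x - 1)) * (-1/(x - 1)^2)) x :=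
      HasDerivAt.comp x (hy' _ hxD) (hs x hx1)
    have hc' : HasDerivAt (fun u : ℂ => y' (u/(u - 1))) (y'' (x/(x - 1)) * (-1/(x - 1)^2)) x :=
      HasDerivAt.comp x (hy'' _ hxD) (hs x hx1)
    have hd := (hc.const_sub 1).add (hc'.div ((hasDerivAt_id x).sub_const 1) hx1')
    refine HasDerivAt.congr_deriv hd ?_
    simp only [id]; field_simp; ring
  · intro x hx
    obtain ⟨hx1, hxD⟩ := hmem x hx
    have hx1' : x - 1 ≠ 0 := sub_ne_zero.mpr hx1
    obtain ⟨a, b, c⟩ := hzne x hx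
    have hx0 : x ≠ 0 := fun e => h0 (e ▸ hx)
    simp only []
    rw [hode _ hxD]
    refine PVI_symmetry_algebra α β γ δ x (z x) _ _ _ hx0 hx1' a (sub_ne_zero.mpr b)
      (sub_ne_zero.mpr c) ?_ rfl
    rw [hzx x hx1, eq_div_iff hx1']
    ring
end

section
/- Let ϑ₁,ϑ₂,ϑ₃,ϑ∞ ∈ ℂ and let (y,p) be a solution of the Garnier system G₁ in Hamiltonian form with parameters (ϑ₁,ϑ₂,ϑ₃,ϑ∞) on an open set D ⊆ ℂ with 0,1 ∉ D and y(x) ∉ {0,1,x} on D. Then: (a) (y, p − ϑ₂/y) is a solution of the same system with parameters (ϑ₁,−ϑ₂,ϑ₃,ϑ∞); (b) (y, p − ϑ₃/(y−1)) is a solution with parameters (ϑ₁,ϑ₂,−ϑ₃,ϑ∞); (c) (y, p − ϑ₁/(y−x)) is a solution with parameters (−ϑ₁,ϑ₂,ϑ₃,ϑ∞). -/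
/-- The birational symmetries changing the signs of `ϑ₂`, `ϑ₃`, `ϑ₁` of the Garnier
system `G₁`: `(y, p − ϑ₂/y)`, `(y, p − ϑ₃/(y−1))`, `(y, p − ϑ₁/(y−x))` solve the
system with parameters `(ϑ₁,−ϑ₂,ϑ₃,ϑ∞)`, `(ϑ₁,ϑ₂,−ϑ₃,ϑ∞)`, `(−ϑ₁,ϑ₂,ϑ₃,ϑ∞)`
respectively. -/
theorem garnier1_sign_symmetries
    (ϑ₁ ϑ₂ ϑ₃ ϑinf : ℂ) (D : Set ℂ) (y p : ℂ → ℂ)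
    (h : IsGarnier1Solution ϑ₁ ϑ₂ ϑ₃ ϑinf D y p) :
    IsGarnier1Solution ϑ₁ (-ϑ₂) ϑ₃ ϑinf D y (fun x => p x - ϑ₂ / y x) ∧
    IsGarnier1Solution ϑ₁ ϑ₂ (-ϑ₃) ϑinf D y (fun x => p x - ϑ₃ / (y x - 1)) ∧
    IsGarnier1Solution (-ϑ₁) ϑ₂ ϑ₃ ϑinf D y (fun x => p x - ϑ₁ / (y x - x)) := by
  obtain ⟨hD, h0, h1, hy, y', p', hy', hp', ey, ep⟩ := h
  refine ⟨?_, ?_, ?_⟩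
  · refine ⟨hD, h0, h1, hy, y', fun x => p' x - (-ϑ₂ * y' x / (y x)^2), hy', ?_, ?_, ?_⟩
    · intro x hx
      obtain ⟨a, b, c⟩ := hy x hx
      have b' := sub_ne_zero.mpr b
      have c' := sub_ne_zero.mpr c
      refine ((hp' x hx).sub ((hasDerivAt_const x ϑ₂).div (hy' x hx) (by assumption))).congr_deriv ?_
      simp only [Pi.sub_apply, id]
      ring
    · intro x hx
      obtain ⟨a, b, c⟩ := hy x hx
      have b' := sub_ne_zero.mpr b
      have c' := sub_ne_zero.mpr c
      have e : x ≠ 0 := fun e => h0 (e ▸ hx)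
      have f : x - 1 ≠ 0 := sub_ne_zero.mpr fun e => h1 (e ▸ hx)
      rw [ey x hx]
      ring
    · intro x hx
      obtain ⟨a, b, c⟩ := hy x hx
      have b' := sub_ne_zero.mpr b
      have c' := sub_ne_zero.mpr c
      have e : x ≠ 0 := fun e => h0 (e ▸ hx)
      have f : x - 1 ≠ 0 := sub_ne_zero.mpr fun e => h1 (e ▸ hx)
      simp only [ey x hx, ep x hx]
      generalize y x = Y at *
      generalize p x = P at *
      field_simp
      ring
  · refine ⟨hD, h0, h1, hy, y', fun x => p' x - (-ϑ₃ * y' x / (y x - 1)^2), hy', ?_, ?_, ?_⟩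
    · intro x hx
      obtain ⟨a, b, c⟩ := hy x hx
      have b' := sub_ne_zero.mpr b
      have c' := sub_ne_zero.mpr c
      refine ((hp' x hx).sub ((hasDerivAt_const x ϑ₃).div ((hy' x hx).sub_const 1) (by assumption))).congr_deriv ?_
      simp only [Pi.sub_apply, id]
      ring
    · intro x hx
      obtain ⟨a, b, c⟩ := hy x hx
      have b' := sub_ne_zero.mpr b
      have c' := sub_ne_zero.mpr c
      have e : x ≠ 0 := fun e => h0 (e ▸ hx)
      have f : x - 1 ≠ 0 := sub_ne_zero.mpr fun e => h1 (e ▸ hx)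
      rw [ey x hx]
      ring
    · intro x hx
      obtain ⟨a, b, c⟩ := hy x hx
      have b' := sub_ne_zero.mpr b
      have c' := sub_ne_zero.mpr c
      have e : x ≠ 0 := fun e => h0 (e ▸ hx)
      have f : x - 1 ≠ 0 := sub_ne_zero.mpr fun e => h1 (e ▸ hx)
      simp only [ey x hx, ep x hx]
      generalize y x = Y at *
      generalize p x = P at *
      field_simp
      ring
  · refine ⟨hD, h0, h1, hy, y', fun x => p' x - (-ϑ₁ * (y' x - 1) / (y x - x)^2), hy', ?_, ?_, ?_⟩
    · intro x hx
      obtain ⟨a, b, c⟩ := hy x hx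
      have b' := sub_ne_zero.mpr b
      have c' := sub_ne_zero.mpr c
      refine ((hp' x hx).sub ((hasDerivAt_const x ϑ₁).div ((hy' x hx).sub (hasDerivAt_id x)) (by assumption))).congr_deriv ?_
      simp only [Pi.sub_apply, id]
      ring
    · intro x hx
      obtain ⟨a, b, c⟩ := hy x hx
      have b' := sub_ne_zero.mpr b
      have c' := sub_ne_zero.mpr c
      have e : x ≠ 0 := fun e => h0 (e ▸ hx)
      have f : x - 1 ≠ 0 := sub_ne_zero.mpr fun e => h1 (e ▸ hx)
      rw [ey x hx]
      ring
    · intro x hx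
      obtain ⟨a, b, c⟩ := hy x hx
      have b' := sub_ne_zero.mpr b
      have c' := sub_ne_zero.mpr c
      have e : x ≠ 0 := fun e => h0 (e ▸ hx)
      have f : x - 1 ≠ 0 := sub_ne_zero.mpr fun e => h1 (e ▸ hx)
      simp only [ey x hx, ep x hx]
      generalize y x = Y at *
      generalize p x = P at *
      field_simp
      ring
end

section
/- Let U be a connected open subset of {u ∈ ℂ^m : u_i ≠ u_j for i ≠ j} and let A₁,…,A_m : U → M_d(ℂ) be differentiable functions satisfying the Schlesinger equations on U. Then for each i = 1,…,m the characteristic polynomial of A_i(u) is independent of u ∈ U; in particular for each i and each positive integer p, the trace of A_i(u)^p is constant on U, and the eigenvalues of A_i(u) (with multiplicity) do not depend on u. -/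
/-- `A₁,…,A_m : U → M_d(ℂ)` are differentiable (entrywise, as functions of
`u ∈ U ⊆ ℂ^m`) and satisfy the Schlesinger equations
`∂A_i/∂u_j = [A_i,A_j]/(u_i−u_j)` for `i ≠ j` and
`∂A_i/∂u_i = −Σ_{j≠i}[A_i,A_j]/(u_i−u_j)`, where partial derivatives are taken
via `Function.update` in the corresponding coordinate. -/
def SatisfiesSchlesinger {m d : ℕ} (U : Set (Fin m → ℂ))
    (A : Fin m → (Fin m → ℂ) → Matrix (Fin d) (Fin d) ℂ) : Prop :=
  (∀ i a b, DifferentiableOn ℂ (fun u => A i u a b) U) ∧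
  (∀ u ∈ U, ∀ i j, i ≠ j → ∀ a b,
    HasDerivAt (fun t => A i (Function.update u j t) a b)
      ((A i u * A j u - A j u * A i u) a b / (u i - u j)) (u j)) ∧
  (∀ u ∈ U, ∀ i, ∀ a b,
    HasDerivAt (fun t => A i (Function.update u i t) a b)
      (-∑ j ∈ Finset.univ.erase i,
        (A i u * A j u - A j u * A i u) a b / (u i - u j)) (u i))


section SchlesingerHelpers

open scoped Matrix.Norms.Operator

theorem schl_entry_diff {d : ℕ} (a b : Fin d) :
    Differentiable ℂ (fun M : Matrix (Fin d) (Fin d) ℂ => M a b) :=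
  (LinearMap.toContinuousLinearMap (Matrix.entryLinearMap ℂ ℂ a b)).differentiable

theorem schl_sum_single {d : ℕ} (M : Matrix (Fin d) (Fin d) ℂ) :
    M = ∑ a, ∑ b, M a b • Matrix.single a b (1 : ℂ) := by
  conv_lhs => rw [Matrix.matrix_eq_sum_single M]
  simp [Matrix.smul_single]

/-- A differentiable conjugation-invariant function has vanishing derivative along commutators. -/
theorem schl_fderiv_comm {d : ℕ} (F : Matrix (Fin d) (Fin d) ℂ → ℂ)
    (hF : Differentiable ℂ F)
    (hinv : ∀ P Q M : Matrix (Fin d) (Fin d) ℂ, P * Q = 1 → F (Q * M * P) = F M)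
    (M B : Matrix (Fin d) (Fin d) ℂ) : fderiv ℂ F M (M * B - B * M) = 0 := by
  have h1 : HasDerivAt (fun t : ℂ => NormedSpace.exp (t • B)) B 0 := by
    have h := hasDerivAt_exp_smul_const (𝕂 := ℂ) B (0 : ℂ)
    rw [zero_smul, NormedSpace.exp_zero, one_mul] at h
    exact h
  have h2 : HasDerivAt (fun t : ℂ => NormedSpace.exp (t • (-B))) (-B) 0 := by
    have h := hasDerivAt_exp_smul_const (𝕂 := ℂ) (-B) (0 : ℂ)
    rw [zero_smul, NormedSpace.exp_zero, one_mul] at h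
    exact h
  have h3 := (h2.mul_const M).mul h1
  have h4 : HasDerivAt (fun t : ℂ => NormedSpace.exp (t • (-B)) * M * NormedSpace.exp (t • B))
      (M * B - B * M) 0 := by
    refine h3.congr_deriv ?_
    simp
    abel
  have h5 : HasFDerivAt F (fderiv ℂ F M)
      (NormedSpace.exp ((0 : ℂ) • (-B)) * M * NormedSpace.exp ((0 : ℂ) • B)) := by
    simpa using (hF M).hasFDerivAt
  have h6 := h5.comp_hasDerivAt (0 : ℂ) h4
  have h7 : (F ∘ fun t : ℂ => NormedSpace.exp (t • (-B)) * M * NormedSpace.exp (t • B))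
      = fun _ => F M := by
    funext t
    refine hinv _ _ M ?_
    rw [smul_neg, Matrix.exp_neg]
    exact Matrix.mul_nonsing_inv _ ((Matrix.isUnit_iff_isUnit_det _).mp (Matrix.isUnit_exp _))
  rw [h7] at h6
  exact h6.unique (hasDerivAt_const _ _)

theorem schl_matrix_hasDerivAt {d : ℕ} {f : ℂ → Matrix (Fin d) (Fin d) ℂ}
    {f' : Matrix (Fin d) (Fin d) ℂ} {x : ℂ}
    (h : ∀ a b, HasDerivAt (fun t => f t a b) (f' a b) x) : HasDerivAt f f' x := by
  have h0 : HasDerivAt (fun t => ∑ a, ∑ b, f t a b • Matrix.single a b (1 : ℂ))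
      (∑ a, ∑ b, f' a b • Matrix.single a b (1 : ℂ)) x :=
    HasDerivAt.fun_sum fun a _ => HasDerivAt.fun_sum fun b _ => (h a b).smul_const _
  rw [← schl_sum_single] at h0
  have : f = fun t => ∑ a, ∑ b, f t a b • Matrix.single a b (1 : ℂ) := by
    funext t
    exact schl_sum_single _
  rw [this]
  exact h0

theorem schl_const {m d : ℕ} (U : Set (Fin m → ℂ))
    (hUopen : IsOpen U) (hUconn : IsConnected U)
    (A : Fin m → (Fin m → ℂ) → Matrix (Fin d) (Fin d) ℂ)
    (hA : SatisfiesSchlesinger U A) (F : Matrix (Fin d) (Fin d) ℂ → ℂ)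
    (hF : Differentiable ℂ F)
    (hinv : ∀ P Q M : Matrix (Fin d) (Fin d) ℂ, P * Q = 1 → F (Q * M * P) = F M)
    (i : Fin m) (u : Fin m → ℂ) (hu : u ∈ U) (v : Fin m → ℂ) (hv : v ∈ U) :
    F (A i u) = F (A i v) := by
  obtain ⟨hd, h1, h2⟩ := hA
  have hAd : DifferentiableOn ℂ (A i) U := by
    have : A i = fun u => ∑ a, ∑ b, A i u a b • Matrix.single a b (1 : ℂ) := by
      funext t
      exact schl_sum_single _
    rw [this]
    exact DifferentiableOn.fun_sum fun a _ => DifferentiableOn.fun_sum fun b _ =>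
      (hd i a b).smul_const _
  have hG : DifferentiableOn ℂ (fun u => F (A i u)) U := hF.comp_differentiableOn hAd
  refine hUopen.is_const_of_fderiv_eq_zero (f := fun u => F (A i u)) hUconn.isPreconnected hG
    ?_ hu hv
  intro w hw
  -- each partial derivative is a commutator
  have key : ∀ j, ∃ B : Matrix (Fin d) (Fin d) ℂ,
      HasDerivAt (fun t => A i (Function.update w j t)) (A i w * B - B * A i w) (w j) := by
    intro j
    by_cases hij : i = j
    · subst hij
      refine ⟨-∑ k ∈ Finset.univ.erase i, (w i - w k)⁻¹ • A k w, ?_⟩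
      apply schl_matrix_hasDerivAt
      intro a b
      refine (h2 w hw i a b).congr_deriv ?_
      have : A i w * (-∑ k ∈ Finset.univ.erase i, (w i - w k)⁻¹ • A k w)
          - (-∑ k ∈ Finset.univ.erase i, (w i - w k)⁻¹ • A k w) * A i w
          = -∑ k ∈ Finset.univ.erase i, (w i - w k)⁻¹ • (A i w * A k w - A k w * A i w) := by
        simp only [smul_sub, Finset.sum_sub_distrib, mul_neg, neg_mul, Finset.mul_sum,
          Finset.sum_mul, mul_smul_comm, smul_mul_assoc]
        abel
      rw [this]
      simp only [Matrix.neg_apply, Matrix.sum_apply, Matrix.smul_apply, smul_eq_mul,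
        div_eq_inv_mul]
    · refine ⟨(w i - w j)⁻¹ • A j w, ?_⟩
      apply schl_matrix_hasDerivAt
      intro a b
      refine (h1 w hw i j hij a b).congr_deriv ?_
      rw [mul_smul_comm, smul_mul_assoc, ← smul_sub, Matrix.smul_apply, smul_eq_mul,
        div_eq_inv_mul]
  have hGw : HasFDerivAt (fun u => F (A i u)) (fderiv ℂ (fun u => F (A i u)) w) w :=
    (hG.differentiableAt (hUopen.mem_nhds hw)).hasFDerivAt
  have hz : ∀ j, fderiv ℂ (fun u => F (A i u)) w (Pi.single j 1) = 0 := by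
    intro j
    obtain ⟨B, hB⟩ := key j
    have e1 : HasFDerivAt (fun u => F (A i u)) (fderiv ℂ (fun u => F (A i u)) w)
        (Function.update w j (w j)) := by
      simpa using hGw
    have e2 := e1.comp_hasDerivAt (w j) (hasDerivAt_update w j (w j))
    have e3 : HasFDerivAt F (fderiv ℂ F (A i w)) (A i (Function.update w j (w j))) := by
      simpa using (hF (A i w)).hasFDerivAt
    have e4 := e3.comp_hasDerivAt (w j) hB
    exact (e2.unique e4).trans (schl_fderiv_comm F hF hinv (A i w) B)
  ext x
  have hx : x = ∑ j, x j • (Pi.single j (1 : ℂ) : Fin m → ℂ) := by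
    funext k
    simp [Finset.sum_apply, Pi.single_apply]
  rw [hx, map_sum]
  simp [hz]

theorem schl_diff_det {d : ℕ} (x : ℂ) :
    Differentiable ℂ (fun M : Matrix (Fin d) (Fin d) ℂ => M.charpoly.eval x) := by
  simp only [Matrix.eval_charpoly, Matrix.det_apply]
  refine Differentiable.fun_sum fun σ _ => ?_
  refine Differentiable.const_smul ?_ _
  have hk : ∀ k : Fin d, Differentiable ℂ (fun M : Matrix (Fin d) (Fin d) ℂ =>
      (Matrix.scalar (Fin d) x - M) (σ k) k) := by
    intro k
    simp only [Matrix.sub_apply]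
    exact (differentiable_const _).sub (schl_entry_diff _ _)
  intro M
  exact (HasFDerivAt.finsetProd (𝕜 := ℂ) (u := Finset.univ)
    fun k _ => (hk k M).hasFDerivAt).differentiableAt

theorem schl_diff_trace {d : ℕ} (p : ℕ) :
    Differentiable ℂ (fun M : Matrix (Fin d) (Fin d) ℂ => (M ^ p).trace) :=
  (LinearMap.toContinuousLinearMap (Matrix.traceLinearMap (Fin d) ℂ ℂ)).differentiable.comp
    (differentiable_id.pow p)

theorem schl_inv_charpoly {d : ℕ} (P Q M : Matrix (Fin d) (Fin d) ℂ) (h : P * Q = 1) :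
    (Q * M * P).charpoly = M.charpoly := by
  rw [Matrix.charpoly_mul_comm, ← mul_assoc, h, one_mul]

theorem schl_inv_trace {d : ℕ} (p : ℕ) (P Q M : Matrix (Fin d) (Fin d) ℂ) (h : P * Q = 1) :
    ((Q * M * P) ^ p).trace = (M ^ p).trace := by
  have h' : Q * P = 1 := mul_eq_one_comm.mp h
  have : (Q * M * P) ^ p = Q * M ^ p * P := by
    induction p with
    | zero => simp [h']
    | succ n ih =>
      rw [pow_succ, ih, pow_succ]
      calc Q * M ^ n * P * (Q * M * P) = Q * M ^ n * (P * Q) * M * P := by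
            simp only [mul_assoc]
        _ = _ := by rw [h]; simp only [mul_assoc, one_mul]
  rw [this, Matrix.trace_mul_comm, ← mul_assoc, h, one_mul]

end SchlesingerHelpers

/-- For a solution of the Schlesinger equations on a connected open set `U` of
pairwise-distinct pole configurations, the characteristic polynomial of each
`A_i(u)` is independent of `u`; in particular the traces of all powers `A_i(u)^p`
(`p > 0`) are constant and the eigenvalues (with multiplicity, i.e. the roots of
the characteristic polynomial) do not depend on `u`. -/
theorem schlesinger_charpoly_constant {m d : ℕ} (U : Set (Fin m → ℂ))
    (hUopen : IsOpen U) (hUconn : IsConnected U)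
    (hUdist : U ⊆ {u : Fin m → ℂ | ∀ i j, i ≠ j → u i ≠ u j})
    (A : Fin m → (Fin m → ℂ) → Matrix (Fin d) (Fin d) ℂ)
    (hA : SatisfiesSchlesinger U A) :
    ∀ i, ∀ u ∈ U, ∀ v ∈ U,
      (A i u).charpoly = (A i v).charpoly ∧
      (∀ p : ℕ, 0 < p → ((A i u) ^ p).trace = ((A i v) ^ p).trace) ∧
      (A i u).charpoly.roots = (A i v).charpoly.roots := by
  intro i u hu v hv
  have hc : (A i u).charpoly = (A i v).charpoly := by
    refine Polynomial.funext fun x => ?_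
    exact schl_const U hUopen hUconn A hA _ (schl_diff_det x)
      (fun P Q M h => by simp only [schl_inv_charpoly P Q M h]) i u hu v hv
  refine ⟨hc, fun p _ => ?_, by rw [hc]⟩
  exact schl_const U hUopen hUconn A hA _ (schl_diff_trace p)
    (fun P Q M h => schl_inv_trace p P Q M h) i u hu v hv
end

section
/- Let ϑ∞ ∈ ℂ with ϑ∞ ∉ {−1, −2}. Let U be a connected open subset of {u ∈ ℂ^m : u_i ≠ u_j for i ≠ j} and let A₁,…,A_m : U → M₂(ℂ) be differentiable functions satisfying the Schlesinger equations on U, with −Σ_{k=1}^m A_k(u) = diag(ϑ∞/2, −ϑ∞/2) for all u ∈ U. If Σ_{k=1}^m (A_k(u))₂₁ · u_k = 0 for all u ∈ U, then (A_k)₂₁ ≡ 0 on U for every k = 1,…,m. (In other words, the constraint Σ_k (A_k)₂₁ u_k = 0 is compatible with the Schlesinger equations only for solutions whose residue matrices all have vanishing (2,1) entry.) -/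
/-- Let `ϑ∞ ∉ {−1,−2}` and let `A₁,…,A_m : U → M₂(ℂ)` solve the Schlesinger
equations with `−Σ_k A_k = diag(ϑ∞/2, −ϑ∞/2)` on `U`. If `Σ_k (A_k)₂₁ u_k ≡ 0`
on `U`, then all the `(2,1)` entries `(A_k)₂₁` vanish identically on `U`. -/
theorem schlesinger_21_constraint {m : ℕ} (ϑinf : ℂ)
    (hϑ1 : ϑinf ≠ -1) (hϑ2 : ϑinf ≠ -2)
    (U : Set (Fin m → ℂ))
    (hUopen : IsOpen U) (hUconn : IsConnected U)
    (hUdist : U ⊆ {u : Fin m → ℂ | ∀ i j, i ≠ j → u i ≠ u j})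
    (A : Fin m → (Fin m → ℂ) → Matrix (Fin 2) (Fin 2) ℂ)
    (hA : SatisfiesSchlesinger U A)
    (hAinf : ∀ u ∈ U, -∑ k, A k u = Matrix.diagonal ![ϑinf / 2, -ϑinf / 2])
    (hsum : ∀ u ∈ U, ∑ k, (A k u) 1 0 * u k = 0) :
    ∀ u ∈ U, ∀ k, (A k u) 1 0 = 0 := by
  intro u hu j
  obtain ⟨-, h1, h2⟩ := hA
  have hne : ∀ i, i ≠ j → u i - u j ≠ 0 := fun i hi => sub_ne_zero.mpr (hUdist hu i j hi)
  set c : Fin m → ℂ := fun i => (A i u * A j u - A j u * A i u) 1 0 with hc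
  set D : Fin m → ℂ := fun i => if i = j then -∑ l ∈ Finset.univ.erase j, c l / (u l - u j)
    else c i / (u i - u j) with hD
  have hder : ∀ i, HasDerivAt (fun t => A i (Function.update u j t) 1 0) (D i) (u j) := by
    intro i
    by_cases hi : i = j
    · subst hi
      have := h2 u hu i 1 0
      convert this using 1
      simp only [hD, if_true, hc]
      congr 1
      refine Finset.sum_congr rfl fun l hl => ?_
      rw [← neg_sub (u i) (u l), div_neg, ← neg_div]
      congr 1
      simp only [Matrix.sub_apply]
      ring
    · simp only [hD, if_neg hi]
      exact h1 u hu i j hi 1 0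
  have hid : ∀ i, HasDerivAt (fun t => Function.update u j t i) (if i = j then 1 else 0) (u j) := by
    intro i
    by_cases hi : i = j
    · subst hi
      simpa using hasDerivAt_id' (u i)
    · simpa [hi] using hasDerivAt_const (u j) (u i)
  have hS : HasDerivAt (fun t => ∑ i, A i (Function.update u j t) 1 0 * Function.update u j t i)
      (∑ i, (D i * u i + A i u 1 0 * (if i = j then 1 else 0))) (u j) := by
    apply HasDerivAt.fun_sum
    intro i _
    simpa using (hder i).fun_mul (hid i)
  have hmem : ∀ᶠ t in nhds (u j), Function.update u j t ∈ U := by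
    have hcont : Continuous fun t : ℂ => Function.update u j t :=
      continuous_const.update j continuous_id
    apply hcont.continuousAt.eventually_mem
    simpa using hUopen.mem_nhds hu
  have h0 : HasDerivAt (fun t => ∑ i, A i (Function.update u j t) 1 0 * Function.update u j t i)
      0 (u j) := by
    refine (hasDerivAt_const (u j) (0 : ℂ)).congr_of_eventuallyEq ?_
    filter_upwards [hmem] with t ht
    exact hsum _ ht
  have heq := hS.unique h0
  have hDsum : ∑ i, D i * u i = ∑ i, c i := by
    have hcj : c j = 0 := by simp [hc]
    rw [← Finset.add_sum_erase _ _ (Finset.mem_univ j),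
      ← Finset.add_sum_erase _ c (Finset.mem_univ j), hcj, zero_add]
    have : D j = -∑ l ∈ Finset.univ.erase j, c l / (u l - u j) := by simp [hD]
    rw [this, neg_mul, Finset.sum_mul, ← Finset.sum_neg_distrib, ← Finset.sum_add_distrib]
    refine Finset.sum_congr rfl fun l hl => ?_
    have hl' := Finset.ne_of_mem_erase hl
    have := hne l hl'
    simp only [hD, if_neg hl']
    field_simp
    ring
  have hcsum : ∑ i, c i = ϑinf * A j u 1 0 := by
    have hs : ∑ k, A k u = -Matrix.diagonal ![ϑinf / 2, -ϑinf / 2] := by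
      rw [← hAinf u hu, neg_neg]
    have : ∑ i, c i = ((∑ i, A i u) * A j u - A j u * ∑ i, A i u) 1 0 := by
      rw [Finset.sum_mul, Finset.mul_sum, ← Finset.sum_sub_distrib, Matrix.sum_apply]
    rw [this, hs]
    simp [Matrix.diagonal_mul, Matrix.mul_diagonal]
    ring
  rw [Finset.sum_add_distrib, hDsum, hcsum] at heq
  simp at heq
  have hfac : (ϑinf + 1) * A j u 1 0 = 0 := by linear_combination heq
  exact (mul_eq_zero.mp hfac).resolve_left fun h => hϑ1 (eq_neg_of_add_eq_zero_left h)
end
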